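/- Let p and q be probability densities with respect to μ and suppose there exist 0 < ζ̲ ≤ ζ̄ < ∞ with ζ̲ ≤ p(x) ≤ ζ̄ and ζ̲ ≤ q(x) ≤ ζ̄ for μ-a.e. x in the support of p. Put c = ζ̲/ζ̄ and r = (log c)²/(c − 1)². Then ∫_{{p>0}} p(x) (log(p(x)/q(x)))² dμ(x) ≤ (ζ̄ r / ζ̲²) ∫ (p(x) − q(x))² dμ(x). -/

import Mathlib

open MeasureTheory

/-- For `c < 1`, the quotient `|log t| / |t - 1|` on `[c, ∞)` is at most its value at `c`. -/
lemma abs_log_mul_one_sub_le {c t : ℝ} (hc : 0 < c) (hc1 : c < 1) (hct : c ≤ t) :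
    |Real.log t| * (1 - c) ≤ |Real.log c| * |t - 1| := by
  have ht : 0 < t := hc.trans_le hct
  have hd : 0 < 1 - c := sub_pos.2 hc1
  rw [abs_of_neg (Real.log_neg hc hc1)]
  rcases le_or_gt 1 t with h1 | h1
  · rw [abs_of_nonneg (Real.log_nonneg h1), abs_of_nonneg (sub_nonneg.2 h1), mul_comm (-_)]
    have := Real.log_le_sub_one_of_pos hc
    exact mul_le_mul (Real.log_le_sub_one_of_pos ht) (by linarith) hd.le (sub_nonneg.2 h1)
  · rw [abs_of_neg (Real.log_neg ht h1), abs_of_neg (sub_neg.2 h1)]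
    have key := strictConcaveOn_log_Ioi.concaveOn.2 (Set.mem_Ioi.2 hc) (Set.mem_Ioi.2 one_pos)
      (div_nonneg (sub_nonneg.2 h1.le) hd.le) (div_nonneg (sub_nonneg.2 hct) hd.le)
      (by field_simp; ring)
    have hcomb : (1 - t) / (1 - c) * c + (t - c) / (1 - c) * 1 = t := by
      field_simp
      ring
    simp only [smul_eq_mul, Real.log_one, mul_zero, add_zero, hcomb] at key
    rw [div_mul_eq_mul_div, div_le_iff₀ hd] at key
    linarith

/-- For `a, b ∈ [l, u]`, the squared log-ratio `(log (a / b))²`, weighted by `a`, is controlled by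
the squared difference `(a - b)²`. -/
lemma mul_sq_log_div_le {l u a b : ℝ} (hl : 0 < l) (hla : l ≤ a) (hau : a ≤ u)
    (hlb : l ≤ b) (hbu : b ≤ u) :
    a * Real.log (a / b) ^ 2 ≤
      u * (Real.log (l / u) ^ 2 / (l / u - 1) ^ 2) / l ^ 2 * (a - b) ^ 2 := by
  have ha : 0 < a := hl.trans_le hla
  have hb : 0 < b := hl.trans_le hlb
  have hu : 0 < u := ha.trans_le hau
  rcases (hla.trans hau).eq_or_lt with rfl | hlu
  · obtain rfl : a = l := le_antisymm hau hla
    obtain rfl : b = a := le_antisymm hbu hlb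
    simp [hb.ne']
  have hc1 : l / u < 1 := (div_lt_one hu).2 hlu
  have hlog : Real.log (a / b) ^ 2 ≤
      Real.log (l / u) ^ 2 / (l / u - 1) ^ 2 * (a / b - 1) ^ 2 := by
    have h := abs_log_mul_one_sub_le (div_pos hl hu) hc1 (div_le_div₀ ha.le hla hb hbu)
    have h2 := pow_le_pow_left₀ (mul_nonneg (abs_nonneg _) (sub_nonneg.2 hc1.le)) h 2
    rw [mul_pow, mul_pow, sq_abs, sq_abs, sq_abs] at h2
    rw [div_mul_eq_mul_div, le_div_iff₀ (sq_pos_of_neg (sub_neg.2 hc1))]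
    rwa [← sub_sq_comm 1 (l / u)]
  have hratio : (a / b - 1) ^ 2 ≤ (a - b) ^ 2 / l ^ 2 := by
    rw [div_sub_one hb.ne', div_pow]
    gcongr
  calc a * Real.log (a / b) ^ 2
      ≤ u * (Real.log (l / u) ^ 2 / (l / u - 1) ^ 2 * ((a - b) ^ 2 / l ^ 2)) := by
        refine mul_le_mul hau (hlog.trans ?_) (sq_nonneg _) hu.le
        gcongr
    _ = _ := by ring

/-- For probability densities `p, q` w.r.t. a σ-finite measure `μ` on ℝ^d,
if `ζl ≤ p, q ≤ ζu` μ-a.e. on the support of `p`, with `c = ζl/ζu` and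
`r = (log c)²/(c-1)²`, then
`∫_{p>0} p (log(p/q))² dμ ≤ (ζu r / ζl²) ∫ (p-q)² dμ`. -/
theorem second_moment_log_ratio_le_mise
    {d : ℕ} (μ : Measure (Fin d → ℝ)) [SigmaFinite μ]
    (p q : (Fin d → ℝ) → ℝ) (ζl ζu : ℝ) (hζl : 0 < ζl) (hζu : ζl ≤ ζu)
    (hp_meas : Measurable p) (hq_meas : Measurable q)
    (hp_nonneg : ∀ x, 0 ≤ p x) (hq_nonneg : ∀ x, 0 ≤ q x)
    (hp_one : ∫ x, p x ∂μ = 1) (hq_one : ∫ x, q x ∂μ = 1)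
    (hbounds : ∀ᵐ x ∂μ, 0 < p x → (ζl ≤ p x ∧ p x ≤ ζu ∧ ζl ≤ q x ∧ q x ≤ ζu))
    (hmise : Integrable (fun x => (p x - q x) ^ 2) μ) :
    ∫ x in {x | 0 < p x}, p x * (Real.log (p x / q x)) ^ 2 ∂μ
      ≤ (ζu * ((Real.log (ζl / ζu)) ^ 2 / (ζl / ζu - 1) ^ 2) / ζl ^ 2)
          * ∫ x, (p x - q x) ^ 2 ∂μ := by
  have hs : MeasurableSet {x | 0 < p x} := measurableSet_lt measurable_const hp_meas
  have hζu0 : 0 ≤ ζu := hζl.le.trans hζu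
  rw [← integral_const_mul, ← integral_indicator hs]
  refine integral_mono_of_nonneg (.of_forall fun x => Set.indicator_nonneg
    (fun y _ => mul_nonneg (hp_nonneg y) (sq_nonneg _)) x) (hmise.const_mul _) ?_
  filter_upwards [hbounds] with x hx
  by_cases h : 0 < p x
  · obtain ⟨hlp, hpu, hlq, hqu⟩ := hx h
    rw [Set.indicator_of_mem (show x ∈ {x | 0 < p x} from h)]
    exact mul_sq_log_div_le hζl hlp hpu hlq hqu
  · rw [Set.indicator_of_notMem (show x ∉ {x | 0 < p x} from h)]
    positivity
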